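/- If Ψ ≥ 10^4·k^3/ε^2 for some ε ∈ (0,1), then for all distinct i,j ∈ {1,…,k}: 1 − ε ≤ ⟨B_{i,:}, B_{i,:}⟩ ≤ 1 + ε, and |⟨B_{i,:}, B_{j,:}⟩| ≤ √ε, where B_{i,:} denotes the i-th row of the matrix B. -/

import Mathlib

open Finset BigOperators Matrix

namespace SpectralClustering

variable {V : Type} [Fintype V] [DecidableEq V]

/-- Volume of a vertex set: the sum of the degrees of its vertices. -/
def vol (G : SimpleGraph V) [DecidableRel G.Adj] (S : Finset V) : ℕ :=
  ∑ v ∈ S, G.degree v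

/-- Number of edges between two (disjoint) vertex sets. -/
def cut (G : SimpleGraph V) [DecidableRel G.Adj] (S T : Finset V) : ℕ :=
  ∑ u ∈ S, (T.filter fun v => G.Adj u v).card

/-- Conductance `φ(S) = |E(S, V \ S)| / μ(S)`. -/
noncomputable def conductance (G : SimpleGraph V) [DecidableRel G.Adj] (S : Finset V) : ℝ :=
  (cut G S Sᶜ : ℝ) / (vol G S : ℝ)

/-- A `k`-way partition of the vertex set into nonempty blocks. -/
def IsKWayPartition {k : ℕ} (P : Fin k → Finset V) : Prop :=
  (∀ i, (P i).Nonempty) ∧ (∀ i j, i ≠ j → Disjoint (P i) (P j)) ∧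
    (∀ v : V, ∃ i, v ∈ P i)

/-- Maximum conductance over the blocks of a tuple of sets. -/
noncomputable def maxCond (G : SimpleGraph V) [DecidableRel G.Adj] {k : ℕ}
    (P : Fin k → Finset V) : ℝ :=
  ⨆ i, conductance G (P i)

/-- Average conductance of the blocks. -/
noncomputable def avgCond (G : SimpleGraph V) [DecidableRel G.Adj] {k : ℕ}
    (P : Fin k → Finset V) : ℝ :=
  (∑ i, conductance G (P i)) / (k : ℝ)

/-- `P` achieves `ρ̂_avr(k)`: it minimizes the maximum conductance among all
`k`-way partitions, and among those it has minimal average conductance. -/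
def AchievesRhoAvr (G : SimpleGraph V) [DecidableRel G.Adj] {k : ℕ}
    (P : Fin k → Finset V) : Prop :=
  IsKWayPartition P ∧
  (∀ Q : Fin k → Finset V, IsKWayPartition Q → maxCond G P ≤ maxCond G Q) ∧
  (∀ Q : Fin k → Finset V, IsKWayPartition Q → maxCond G Q = maxCond G P →
    avgCond G P ≤ avgCond G Q)

/-- Dot product of two vectors indexed by the vertices. -/
def dotV (x y : V → ℝ) : ℝ := ∑ v, x v * y v

/-- The normalized Laplacian `I - D^{-1/2} A D^{-1/2}`. -/
noncomputable def normLap (G : SimpleGraph V) [DecidableRel G.Adj] : Matrix V V ℝ :=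
  1 - Matrix.diagonal (fun v => (Real.sqrt (G.degree v))⁻¹) * G.adjMatrix ℝ *
      Matrix.diagonal (fun v => (Real.sqrt (G.degree v))⁻¹)

/-- `f` is an orthonormal family of eigenvectors of the normalized Laplacian of `G`
with (sorted) eigenvalues `lam`. -/
structure EigenData (G : SimpleGraph V) [DecidableRel G.Adj]
    (f : Fin (Fintype.card V) → V → ℝ) (lam : Fin (Fintype.card V) → ℝ) : Prop where
  eig : ∀ i, (normLap G).mulVec (f i) = lam i • f i
  ortho : ∀ i j, dotV (f i) (f j) = if i = j then (1 : ℝ) else 0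
  mono : Monotone lam

/-- The gap parameter `Ψ = λ_{k+1} / ρ̂_avr(k)`, where `ρ̂_avr(k)` is realized as the
average conductance of the fixed optimal partition `P`. -/
noncomputable def Psi (G : SimpleGraph V) [DecidableRel G.Adj]
    (lam : Fin (Fintype.card V) → ℝ) {k : ℕ} (P : Fin k → Finset V)
    (hkn : k < Fintype.card V) : ℝ :=
  lam ⟨k, hkn⟩ / avgCond G P

/-- The spectral embedding `F(u) = d_u^{-1/2} (f_1(u), …, f_k(u))`. -/
noncomputable def Femb (G : SimpleGraph V) [DecidableRel G.Adj]
    (f : Fin (Fintype.card V) → V → ℝ) {k : ℕ} (hk : k ≤ Fintype.card V) (u : V) :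
    Fin k → ℝ :=
  fun j => f (Fin.castLE hk j) u / Real.sqrt (G.degree u)

/-- `k`-means cost of a clustering of the (degree-weighted) spectral embedding:
`∑_i ∑_{u ∈ A_i} d_u ‖F(u) - c_i‖²`. -/
noncomputable def kmCost (G : SimpleGraph V) [DecidableRel G.Adj]
    (f : Fin (Fintype.card V) → V → ℝ) {k : ℕ} (hk : k ≤ Fintype.card V) {ℓ : ℕ}
    (A : Fin ℓ → Finset V) (c : Fin ℓ → Fin k → ℝ) : ℝ :=
  ∑ i, ∑ u ∈ A i, (G.degree u : ℝ) * ∑ j, (Femb G f hk u j - c i j) ^ 2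

/-- `Δ_ℓ(𝒳_V)`: the optimal `ℓ`-means cost of the spectral embedding multiset `𝒳_V`
(which contains `d_u` copies of `F(u)` for every vertex `u`). -/
noncomputable def kmOpt (G : SimpleGraph V) [DecidableRel G.Adj]
    (f : Fin (Fintype.card V) → V → ℝ) {k : ℕ} (hk : k ≤ Fintype.card V) (ℓ : ℕ) : ℝ :=
  sInf { r : ℝ | ∃ (A : Fin ℓ → Finset V) (c : Fin ℓ → Fin k → ℝ),
    (∀ i j, i ≠ j → Disjoint (A i) (A j)) ∧ (∀ v : V, ∃ i, v ∈ A i) ∧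
    r = kmCost G f hk A c }

/-- Normalized characteristic vector `ḡ_i = D^{1/2} χ_{P_i} / √μ(P_i)`. -/
noncomputable def gbar (G : SimpleGraph V) [DecidableRel G.Adj] {k : ℕ}
    (P : Fin k → Finset V) (i : Fin k) : V → ℝ :=
  fun v => (if v ∈ P i then Real.sqrt (G.degree v) else 0) / Real.sqrt (vol G (P i))

/-- Coefficients `α_j^{(i)} = ⟨ḡ_i, f_j⟩` of `ḡ_i` in the eigenbasis. -/
noncomputable def alpha (G : SimpleGraph V) [DecidableRel G.Adj] {k : ℕ}
    (P : Fin k → Finset V) (f : Fin (Fintype.card V) → V → ℝ)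
    (i : Fin k) (j : Fin (Fintype.card V)) : ℝ :=
  dotV (gbar G P i) (f j)

/-- Projection `f̂_i = ∑_{j=1}^k α_j^{(i)} f_j` of `ḡ_i` onto the first `k` eigenvectors. -/
noncomputable def fhat (G : SimpleGraph V) [DecidableRel G.Adj] {k : ℕ}
    (P : Fin k → Finset V) (f : Fin (Fintype.card V) → V → ℝ) (i : Fin k) : V → ℝ :=
  fun v => ∑ j : Fin (Fintype.card V),
    if (j : ℕ) < k then alpha G P f i j * f j v else 0

/-- Estimation center `p^{(i)} = μ(P_i)^{-1/2} (β_i^{(1)}, …, β_i^{(k)})`;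
here `beta i j` denotes `β_j^{(i)}`. -/
noncomputable def estCenter (G : SimpleGraph V) [DecidableRel G.Adj] {k : ℕ}
    (P : Fin k → Finset V) (beta : Fin k → Fin k → ℝ) (i : Fin k) : Fin k → ℝ :=
  fun j => beta j i / Real.sqrt (vol G (P i))

/-- The normalized Laplacian is the congruence of the Laplacian by `D^{-1/2}`. -/
lemma normLap_eq_diagonal_mul_lapMatrix_mul_diagonal (G : SimpleGraph V) [DecidableRel G.Adj]
    (hd : ∀ v, 0 < G.degree v) :
    normLap G = diagonal (fun v => (Real.sqrt (G.degree v))⁻¹) * G.lapMatrix ℝ *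
      diagonal (fun v => (Real.sqrt (G.degree v))⁻¹) := by
  rw [SimpleGraph.lapMatrix, SimpleGraph.degMatrix, mul_sub, sub_mul, diagonal_mul_diagonal,
    diagonal_mul_diagonal, normLap, ← diagonal_one]
  congr 2
  funext v
  have h : (0 : ℝ) < G.degree v := by exact_mod_cast hd v
  have hs : Real.sqrt (G.degree v) ≠ 0 := (Real.sqrt_pos.2 h).ne'
  field_simp
  rw [Real.sq_sqrt h.le]

lemma normLap_transpose (G : SimpleGraph V) [DecidableRel G.Adj] :
    (normLap G)ᵀ = normLap G := by
  simp [normLap, transpose_mul, mul_assoc]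

lemma dotV_normLap_mulVec (G : SimpleGraph V) [DecidableRel G.Adj] (x y : V → ℝ) :
    dotV ((normLap G).mulVec x) y = dotV x ((normLap G).mulVec y) := by
  change (normLap G).mulVec x ⬝ᵥ y = x ⬝ᵥ (normLap G).mulVec y
  rw [dotProduct_mulVec, ← mulVec_transpose, normLap_transpose]

lemma dotV_self_normLap (G : SimpleGraph V) [DecidableRel G.Adj]
    (hd : ∀ v, 0 < G.degree v) (x : V → ℝ) :
    dotV x ((normLap G).mulVec x) =
      (fun v => (Real.sqrt (G.degree v))⁻¹ * x v) ⬝ᵥ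
        (G.lapMatrix ℝ).mulVec (fun v => (Real.sqrt (G.degree v))⁻¹ * x v) := by
  have h : (diagonal fun v => (Real.sqrt (G.degree v))⁻¹).mulVec x =
      fun v => (Real.sqrt (G.degree v))⁻¹ * x v := by
    funext v
    rw [mulVec_diagonal]
  change x ⬝ᵥ (normLap G).mulVec x = _
  rw [normLap_eq_diagonal_mul_lapMatrix_mul_diagonal G hd, ← mulVec_mulVec, ← mulVec_mulVec,
    dotProduct_mulVec, ← mulVec_transpose, diagonal_transpose, h]

lemma dotV_self_normLap_nonneg (G : SimpleGraph V) [DecidableRel G.Adj]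
    (hd : ∀ v, 0 < G.degree v) (x : V → ℝ) : 0 ≤ dotV x ((normLap G).mulVec x) := by
  rw [dotV_self_normLap G hd]
  simpa using (G.posSemidef_lapMatrix ℝ).dotProduct_mulVec_nonneg
    (fun v => (Real.sqrt (G.degree v))⁻¹ * x v)

/-- The Laplacian quadratic form of an indicator vector is the size of the cut. -/
lemma indicator_dotProduct_lapMatrix (G : SimpleGraph V) [DecidableRel G.Adj] (S : Finset V) :
    (fun v => if v ∈ S then (1 : ℝ) else 0) ⬝ᵥ
      (G.lapMatrix ℝ).mulVec (fun v => if v ∈ S then (1 : ℝ) else 0) = cut G S Sᶜ := by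
  simp only [dotProduct, SimpleGraph.lapMatrix_mulVec_apply, ite_mul, one_mul, zero_mul, cut,
    Nat.cast_sum]
  rw [← Finset.sum_filter]
  simp only [Finset.filter_mem_eq_inter, Finset.univ_inter]
  refine Finset.sum_congr rfl fun u hu => ?_
  have hdeg : G.degree u = (S.filter fun v => G.Adj u v).card +
      (Sᶜ.filter fun v => G.Adj u v).card := by
    rw [← G.card_neighborFinset_eq_degree, ← Finset.card_union_of_disjoint]
    · congr 1
      ext v
      simp only [SimpleGraph.mem_neighborFinset, Finset.mem_union, Finset.mem_filter,
        Finset.mem_compl]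
      tauto
    · exact Finset.disjoint_filter_filter disjoint_compl_right
  have hN : ∑ v ∈ G.neighborFinset u, (if v ∈ S then (1 : ℝ) else 0) =
      (S.filter fun v => G.Adj u v).card := by
    rw [Finset.sum_boole]
    congr 2
    ext v
    simp only [SimpleGraph.mem_neighborFinset, Finset.mem_filter]
    tauto
  rw [if_pos hu, hN, hdeg]
  push_cast
  ring

lemma vol_pos (G : SimpleGraph V) [DecidableRel G.Adj] (hd : ∀ v, 0 < G.degree v)
    {S : Finset V} (hS : S.Nonempty) : 0 < vol G S :=
  Finset.sum_pos (fun v _ => hd v) hS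

lemma conductance_nonneg (G : SimpleGraph V) [DecidableRel G.Adj] (S : Finset V) :
    0 ≤ conductance G S := by
  unfold conductance
  positivity

lemma dotV_gbar_normLap (G : SimpleGraph V) [DecidableRel G.Adj] (hd : ∀ v, 0 < G.degree v)
    {k : ℕ} (P : Fin k → Finset V) (i : Fin k) :
    dotV (gbar G P i) ((normLap G).mulVec (gbar G P i)) = conductance G (P i) := by
  have h : (fun v => (Real.sqrt (G.degree v))⁻¹ * gbar G P i v) =
      (Real.sqrt (vol G (P i)))⁻¹ • fun v => if v ∈ P i then (1 : ℝ) else 0 := by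
    funext v
    have hs : Real.sqrt (G.degree v) ≠ 0 := (Real.sqrt_pos.2 (by exact_mod_cast hd v)).ne'
    by_cases hv : v ∈ P i
    · simp only [gbar, hv, if_true, Pi.smul_apply, smul_eq_mul]
      field_simp
    · simp [gbar, hv]
  rw [dotV_self_normLap G hd, h, mulVec_smul, dotProduct_smul, smul_dotProduct,
    indicator_dotProduct_lapMatrix, smul_eq_mul, smul_eq_mul, ← mul_assoc, ← mul_inv,
    Real.mul_self_sqrt (Nat.cast_nonneg _), conductance, div_eq_inv_mul]

lemma dotV_gbar_gbar (G : SimpleGraph V) [DecidableRel G.Adj] (hd : ∀ v, 0 < G.degree v)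
    {k : ℕ} {P : Fin k → Finset V} (hP : IsKWayPartition P) (i j : Fin k) :
    dotV (gbar G P i) (gbar G P j) = if i = j then 1 else 0 := by
  unfold dotV
  split_ifs with hij
  · subst hij
    have hv : (0 : ℝ) < vol G (P i) := by exact_mod_cast vol_pos G hd (hP.1 i)
    have h : ∀ v, gbar G P i v * gbar G P i v =
        (if v ∈ P i then (G.degree v : ℝ) else 0) / vol G (P i) := by
      intro v
      rw [gbar, div_mul_div_comm, Real.mul_self_sqrt hv.le]
      split_ifs
      · rw [Real.mul_self_sqrt (Nat.cast_nonneg _)]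
      · simp
    simp only [h]
    rw [← Finset.sum_div, ← Finset.sum_filter, Finset.filter_mem_eq_inter, Finset.univ_inter,
      ← Nat.cast_sum]
    exact div_self hv.ne'
  · refine Finset.sum_eq_zero fun v _ => ?_
    by_cases hi : v ∈ P i
    · simp [gbar, Finset.disjoint_left.1 (hP.2.1 i j hij) hi]
    · simp [gbar, hi]

namespace EigenData

variable {G : SimpleGraph V} [DecidableRel G.Adj]
  {f : Fin (Fintype.card V) → V → ℝ} {lam : Fin (Fintype.card V) → ℝ}

lemma sum_mul_eq_ite (hf : EigenData G f lam) (u v : V) :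
    ∑ m, f m u * f m v = if u = v then 1 else 0 := by
  have h : (Matrix.of f) * (Matrix.of f)ᵀ = 1 := by
    ext a b
    rw [mul_apply, one_apply]
    exact hf.ortho a b
  have h' : (Matrix.of f)ᵀ * (Matrix.of f) = 1 :=
    (mul_eq_one_comm_of_equiv (Fintype.equivFin V).symm).1 h
  have := congrFun (congrFun h' u) v
  rwa [mul_apply, one_apply] at this

lemma dotV_eq_sum (hf : EigenData G f lam) (x y : V → ℝ) :
    dotV x y = ∑ m, dotV x (f m) * dotV y (f m) := by
  simp only [dotV, Finset.sum_mul_sum]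
  rw [Finset.sum_comm]
  refine Finset.sum_congr rfl fun u _ => ?_
  rw [Finset.sum_comm]
  have h : ∀ v, ∑ m, x u * f m u * (y v * f m v) = x u * y v * if u = v then 1 else 0 := by
    intro v
    rw [← hf.sum_mul_eq_ite, Finset.mul_sum]
    exact Finset.sum_congr rfl fun m _ => by ring
  simp [h]

lemma dotV_normLap_eq_sum (hf : EigenData G f lam) (x : V → ℝ) :
    dotV x ((normLap G).mulVec x) = ∑ m, lam m * dotV x (f m) ^ 2 := by
  rw [hf.dotV_eq_sum]
  refine Finset.sum_congr rfl fun m _ => ?_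
  rw [dotV_normLap_mulVec, hf.eig]
  have : dotV x (lam m • f m) = lam m * dotV x (f m) := dotProduct_smul _ _ _
  rw [this]
  ring

lemma lam_nonneg (hf : EigenData G f lam) (hd : ∀ v, 0 < G.degree v)
    (m : Fin (Fintype.card V)) : 0 ≤ lam m := by
  have h := dotV_self_normLap_nonneg G hd (f m)
  have h2 : dotV (f m) (lam m • f m) = lam m * dotV (f m) (f m) := dotProduct_smul _ _ _
  rwa [hf.eig, h2, hf.ortho, if_pos rfl, mul_one] at h

/-- The energy of `x` outside the first `k` eigenvectors is controlled by its Rayleigh form. -/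
lemma lam_mul_tail_le (hf : EigenData G f lam) (hd : ∀ v, 0 < G.degree v) {k : ℕ}
    (hkn : k < Fintype.card V) (x : V → ℝ) :
    lam ⟨k, hkn⟩ * ∑ m ∈ univ.filter (fun m : Fin (Fintype.card V) => ¬ (m : ℕ) < k),
        dotV x (f m) ^ 2 ≤
      dotV x ((normLap G).mulVec x) := by
  rw [hf.dotV_normLap_eq_sum, Finset.mul_sum]
  calc _ ≤ ∑ m ∈ univ.filter (fun m : Fin (Fintype.card V) => ¬ (m : ℕ) < k),
          lam m * dotV x (f m) ^ 2 := by
        refine Finset.sum_le_sum fun m hm => ?_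
        have hm' : k ≤ (m : ℕ) := not_lt.1 (Finset.mem_filter.1 hm).2
        exact mul_le_mul_of_nonneg_right (hf.mono (Fin.mk_le_of_le_val hm')) (sq_nonneg _)
    _ ≤ _ := Finset.sum_le_sum_of_subset_of_nonneg (Finset.filter_subset _ _)
        fun m _ _ => mul_nonneg (hf.lam_nonneg hd m) (sq_nonneg _)

end EigenData

lemma sum_castLE {n k : ℕ} (h : k ≤ n) (g : Fin n → ℝ) :
    ∑ l : Fin k, g (Fin.castLE h l) =
      ∑ m ∈ univ.filter (fun m : Fin n => (m : ℕ) < k), g m := by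
  refine Finset.sum_bij (fun l _ => Fin.castLE h l) (by simp) (by simp) ?_ (by simp)
  intro m hm
  exact ⟨⟨m, (Finset.mem_filter.1 hm).2⟩, by simp, rfl⟩

/-- Entrywise perturbation bound for a left inverse of `1 - E`. -/
lemma abs_sub_one_apply_le_of_mul_one_sub_eq_one {k : ℕ} {M E : Matrix (Fin k) (Fin k) ℝ}
    (h : M * (1 - E) = 1) {τ : ℝ} (hE : ∀ i j, |E i j| ≤ τ) (hτ : k * τ ≤ 1 / 2)
    (i j : Fin k) : |(M - 1) i j| ≤ 2 * τ := by
  have hN : M - 1 = (M - 1) * E + E := by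
    rw [mul_sub, mul_one] at h
    rw [sub_mul, one_mul, sub_add_cancel, ← h, sub_sub_cancel]
  obtain ⟨⟨a, b⟩, -, hab⟩ := Finset.exists_max_image (Finset.univ : Finset (Fin k × Fin k))
    (fun p => |(M - 1) p.1 p.2|) ⟨(i, j), Finset.mem_univ _⟩
  have hmax : ∀ p q, |(M - 1) p q| ≤ |(M - 1) a b| := fun p q => hab (p, q) (Finset.mem_univ _)
  have hsum : |(M - 1) a b| ≤ k * (|(M - 1) a b| * τ) + τ := by
    conv_lhs => rw [hN, Matrix.add_apply, mul_apply]
    refine (abs_add_le _ _).trans (add_le_add ?_ (hE a b))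
    refine (Finset.abs_sum_le_sum_abs _ _).trans ?_
    calc ∑ l, |(M - 1) a l * E l b| ≤ ∑ _l : Fin k, |(M - 1) a b| * τ := by
          refine Finset.sum_le_sum fun l _ => ?_
          rw [abs_mul]
          exact mul_le_mul (hmax a l) (hE l b) (abs_nonneg _) (abs_nonneg _)
      _ = _ := by simp
  have h1 := hmax i j
  nlinarith [mul_le_mul_of_nonneg_right hτ (abs_nonneg ((M - 1) a b))]

/-- The Gram matrix of the components of the `ḡ_i` orthogonal to the first `k` eigenvectors. -/
noncomputable def tailGram (G : SimpleGraph V) [DecidableRel G.Adj] {k : ℕ}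
    (P : Fin k → Finset V) (f : Fin (Fintype.card V) → V → ℝ) : Matrix (Fin k) (Fin k) ℝ :=
  Matrix.of fun i j => ∑ m ∈ univ.filter (fun m : Fin (Fintype.card V) => ¬ (m : ℕ) < k),
    alpha G P f i m * alpha G P f j m

lemma abs_tailGram_le {G : SimpleGraph V} [DecidableRel G.Adj]
    {f : Fin (Fintype.card V) → V → ℝ} {k : ℕ} {P : Fin k → Finset V} {τ : ℝ}
    (h : ∀ i, tailGram G P f i i ≤ τ) (i j : Fin k) : |tailGram G P f i j| ≤ τ := by
  have hb : |tailGram G P f i j| ≤ (tailGram G P f i i + tailGram G P f j j) / 2 := by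
    simp only [tailGram, of_apply]
    rw [← Finset.sum_add_distrib, Finset.sum_div]
    refine (Finset.abs_sum_le_sum_abs _ _).trans (Finset.sum_le_sum fun m _ => ?_)
    rw [abs_le]
    constructor <;>
      nlinarith [sq_nonneg (alpha G P f i m + alpha G P f j m),
        sq_nonneg (alpha G P f i m - alpha G P f j m)]
  linarith [h i, h j]

/-- The coefficient matrix `B` satisfies `B Bᵀ (1 - E) = 1` with `E` the tail Gram matrix. -/
lemma mul_one_sub_tailGram {G : SimpleGraph V} [DecidableRel G.Adj]
    (hd : ∀ v, 0 < G.degree v) {k : ℕ} (hkn : k < Fintype.card V)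
    {f : Fin (Fintype.card V) → V → ℝ} {lam : Fin (Fintype.card V) → ℝ}
    (hf : EigenData G f lam) {P : Fin k → Finset V} (hP : IsKWayPartition P)
    {beta : Fin k → Fin k → ℝ}
    (hbeta : ∀ i : Fin k,
      f (Fin.castLE hkn.le i) = fun v => ∑ j : Fin k, beta i j * fhat G P f j v) :
    (Matrix.of beta)ᵀ * Matrix.of beta * (1 - tailGram G P f) = 1 := by
  set A : Matrix (Fin k) (Fin k) ℝ :=
    Matrix.of fun j l => alpha G P f j (Fin.castLE hkn.le l) with hA
  have hfhat : ∀ j l : Fin k, dotV (fhat G P f j) (f (Fin.castLE hkn.le l)) = A j l := by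
    intro j l
    have hexp : fhat G P f j = ∑ m : Fin (Fintype.card V),
        (if (m : ℕ) < k then alpha G P f j m else 0) • f m := by
      funext v
      simp only [fhat, Finset.sum_apply, Pi.smul_apply, smul_eq_mul, ite_mul, zero_mul]
    change fhat G P f j ⬝ᵥ f (Fin.castLE hkn.le l) = _
    rw [hexp, sum_dotProduct]
    have hterm : ∀ m : Fin (Fintype.card V),
        ((if (m : ℕ) < k then alpha G P f j m else 0) • f m) ⬝ᵥ
        f (Fin.castLE hkn.le l) = if m = Fin.castLE hkn.le l then A j l else 0 := by
      intro m
      rw [smul_dotProduct]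
      change _ • dotV (f m) _ = _
      rw [hf.ortho]
      by_cases h : m = Fin.castLE hkn.le l
      · subst h
        simp [hA]
      · simp [h]
    simp only [hterm, Finset.sum_ite_eq', Finset.mem_univ, if_true]
  have hBA : Matrix.of beta * A = 1 := by
    ext i l
    rw [mul_apply, one_apply]
    have h := hf.ortho (Fin.castLE hkn.le i) (Fin.castLE hkn.le l)
    have hexp : f (Fin.castLE hkn.le i) = ∑ j : Fin k, beta i j • fhat G P f j := by
      rw [hbeta i]
      funext v
      simp [Finset.sum_apply]
    have hsum : dotV (f (Fin.castLE hkn.le i)) (f (Fin.castLE hkn.le l)) =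
        ∑ j, beta i j * A j l := by
      rw [hexp]
      change (∑ j : Fin k, beta i j • fhat G P f j) ⬝ᵥ _ = _
      rw [sum_dotProduct]
      refine Finset.sum_congr rfl fun j _ => ?_
      rw [smul_dotProduct, ← hfhat]
      rfl
    rw [hsum] at h
    simpa [Fin.castLE_inj] using h
  have hAA : 1 - tailGram G P f = A * Aᵀ := by
    ext i j
    have h := hf.dotV_eq_sum (gbar G P i) (gbar G P j)
    rw [dotV_gbar_gbar G hd hP,
      ← Finset.sum_filter_add_sum_filter_not _ (fun m : Fin (Fintype.card V) => (m : ℕ) < k),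
      ← sum_castLE hkn.le] at h
    rw [Matrix.sub_apply, one_apply, h, mul_apply]
    exact add_sub_cancel_right _ _
  have hAB : A * Matrix.of beta = 1 := mul_eq_one_comm.1 hBA
  calc (Matrix.of beta)ᵀ * Matrix.of beta * (1 - tailGram G P f)
      = (Matrix.of beta)ᵀ * (Matrix.of beta * A) * Aᵀ := by rw [hAA]; simp only [mul_assoc]
    _ = (A * Matrix.of beta)ᵀ := by rw [hBA, mul_one, transpose_mul]
    _ = 1 := by rw [hAB, transpose_one]

lemma tailGram_self_le {G : SimpleGraph V} [DecidableRel G.Adj]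
    (hd : ∀ v, 0 < G.degree v) {k : ℕ} (hkn : k < Fintype.card V)
    {f : Fin (Fintype.card V) → V → ℝ} {lam : Fin (Fintype.card V) → ℝ}
    (hf : EigenData G f lam) {P : Fin k → Finset V} (hPsi : 0 < Psi G lam P hkn) (i : Fin k) :
    tailGram G P f i i ≤ k / Psi G lam P hkn := by
  have hk : (0 : ℝ) < k := by exact_mod_cast i.pos
  have hlam : 0 < lam ⟨k, hkn⟩ := (hf.lam_nonneg hd _).lt_of_ne' fun h => by
    simp [Psi, h] at hPsi
  have havg : (k : ℝ) * avgCond G P = ∑ i, conductance G (P i) := by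
    rw [avgCond, mul_div_cancel₀ _ hk.ne']
  have h := hf.lam_mul_tail_le hd hkn (gbar G P i)
  rw [dotV_gbar_normLap G hd] at h
  have hi : conductance G (P i) ≤ k * avgCond G P := by
    rw [havg]
    exact Finset.single_le_sum (f := fun i => conductance G (P i))
      (fun j _ => conductance_nonneg G (P j)) (Finset.mem_univ i)
  have hE : tailGram G P f i i =
      ∑ m ∈ univ.filter (fun m : Fin (Fintype.card V) => ¬ (m : ℕ) < k),
        dotV (gbar G P i) (f m) ^ 2 := by
    simp only [tailGram, of_apply, alpha, sq]
  rw [Psi, div_div_eq_mul_div, le_div_iff₀ hlam, hE, mul_comm]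
  exact h.trans hi

theorem matrix_BBT_close_to_identity
    {V : Type} [Fintype V] [DecidableEq V] (G : SimpleGraph V) [DecidableRel G.Adj]
    (hd : ∀ v : V, 0 < G.degree v)
    {k : ℕ} (hkn : k < Fintype.card V)
    (f : Fin (Fintype.card V) → V → ℝ) (lam : Fin (Fintype.card V) → ℝ)
    (hf : EigenData G f lam)
    (P : Fin k → Finset V) (hP : AchievesRhoAvr G P)
    (beta : Fin k → Fin k → ℝ)
    (hbeta : ∀ i : Fin k,
      f (Fin.castLE hkn.le i) = fun v => ∑ j : Fin k, beta i j * fhat G P f j v)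
    (ε : ℝ) (hε0 : 0 < ε) (hε1 : ε < 1)
    (hPsi : Psi G lam P hkn ≥ (10 : ℝ) ^ 4 * (k : ℝ) ^ 3 / ε ^ 2) :
    (∀ i : Fin k,
        1 - ε ≤ ∑ l : Fin k, beta l i * beta l i ∧
          ∑ l : Fin k, beta l i * beta l i ≤ 1 + ε) ∧
      ∀ i j : Fin k, i ≠ j → |∑ l : Fin k, beta l i * beta l j| ≤ Real.sqrt ε := by
  by_cases hk : k = 0
  · subst hk
    exact ⟨fun i => i.elim0, fun i => i.elim0⟩
  have hk1 : (1 : ℝ) ≤ k := by exact_mod_cast Nat.one_le_iff_ne_zero.2 hk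
  have hpos : 0 < Psi G lam P hkn := lt_of_lt_of_le (by positivity) hPsi
  set τ : ℝ := k / Psi G lam P hkn with hτ
  have hτk : 10 ^ 4 * (k : ℝ) ^ 2 * τ ≤ ε ^ 2 := by
    rw [ge_iff_le, div_le_iff₀ (by positivity)] at hPsi
    rw [hτ, mul_div_assoc', div_le_iff₀ hpos]
    linarith
  have hτ0 : 0 ≤ τ := by positivity
  have hεsq : ε ^ 2 ≤ ε := by nlinarith
  have hkτ : (k : ℝ) * τ ≤ 1 / 2 := by nlinarith [mul_nonneg (by linarith : (0 : ℝ) ≤ k) hτ0]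
  have hτε : 2 * τ ≤ ε := by nlinarith [mul_nonneg (by linarith : (0 : ℝ) ≤ k) hτ0]
  have hentry := abs_sub_one_apply_le_of_mul_one_sub_eq_one
    (mul_one_sub_tailGram hd hkn hf hP.1 hbeta)
    (abs_tailGram_le (tailGram_self_le hd hkn hf hpos)) hkτ
  have happ : ∀ i j, ((Matrix.of beta)ᵀ * Matrix.of beta - 1) i j =
      ∑ l, beta l i * beta l j - if i = j then 1 else 0 := by
    intro i j
    rw [Matrix.sub_apply, mul_apply, one_apply]
    rfl
  refine ⟨fun i => ?_, fun i j hij => ?_⟩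
  · have h := abs_le.1 ((hentry i i).trans hτε)
    rw [happ, if_pos rfl] at h
    constructor <;> linarith [h.1, h.2]
  · have h := (hentry i j).trans hτε
    rw [happ, if_neg hij, sub_zero] at h
    exact h.trans (Real.le_sqrt_of_sq_le hεsq)

end SpectralClustering
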